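/- Let A and B be normal matrices with disjoint spectra, and let δ := dist(σ(A), σ(B)) > 0. If X solves the Sylvester equation AX − XB = Y, then ‖X‖_F ≤ ‖Y‖_F / δ. -/

import Mathlib

open Matrix

noncomputable def frobNormC {m n : ℕ} (A : Matrix (Fin m) (Fin n) ℂ) : ℝ :=
  Real.sqrt (Matrix.trace (Aᴴ * A)).re

theorem normal_diag {m : ℕ} (A : Matrix (Fin m) (Fin m) ℂ) (hA : IsStarNormal A) :
    ∃ (U : unitary (Matrix (Fin m) (Fin m) ℂ)) (d : Fin m → ℂ),
      A = (U : Matrix (Fin m) (Fin m) ℂ) * diagonal d * star (U : Matrix (Fin m) (Fin m) ℂ) := by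
  classical
  have hc : Aᴴ * A = A * Aᴴ := hA.star_comm_self
  set S := A + Aᴴ with hS
  set T := Complex.I • (A - Aᴴ) with hT
  have hSh : S.IsHermitian := by
    simp [Matrix.IsHermitian, hS, add_comm]
  have hTh : T.IsHermitian := by
    simp only [Matrix.IsHermitian, hT, conjTranspose_smul, conjTranspose_sub,
      conjTranspose_conjTranspose]
    rw [← neg_sub A, smul_neg, ← neg_smul]
    simp
  have hST : Commute S T := by
    simp only [Commute, SemiconjBy, hS, hT, mul_smul_comm, smul_mul_assoc]
    congr 1
    simp only [add_mul, mul_sub, mul_add, sub_mul, hc]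
    abel
  have hSs := Matrix.isSymmetric_toEuclideanLin_iff.mpr hSh
  have hTs := Matrix.isSymmetric_toEuclideanLin_iff.mpr hTh
  have hc2 : Commute (toEuclideanLin S) (toEuclideanLin T) := by
    have := hST.map (Matrix.toLinAlgEquiv (PiLp.basisFun 2 ℂ (Fin m)))
    exact this
  have hint := hSs.directSum_isInternal_of_commute hTs hc2
  have horth := hSs.orthogonalFamily_eigenspace_inf_eigenspace hTs
  rw [← DirectSum.isInternal_ne_bot_iff] at hint
  have hfin := horth.independent.fintypeNeBotOfFiniteDimensional
  have horth' := horth.comp (Subtype.val_injective (p := fun i : ℂ × ℂ =>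
    Module.End.eigenspace (toEuclideanLin S) i.2 ⊓ Module.End.eigenspace (toEuclideanLin T) i.1 ≠ ⊥))
  have hn : Module.finrank ℂ (EuclideanSpace ℂ (Fin m)) = m := finrank_euclideanSpace_fin
  let b := hint.subordinateOrthonormalBasis hn horth'
  have hb : ∀ j, ∃ d : ℂ, A *ᵥ ⇑(b j) = d • ⇑(b j) := by
    intro j
    have h := hint.subordinateOrthonormalBasis_subordinate hn j horth'
    obtain ⟨h1, h2⟩ := h
    rw [SetLike.mem_coe, Module.End.mem_eigenspace_iff] at h1 h2
    have h1' : S *ᵥ ⇑(b j) = _ • ⇑(b j) := congr(⇑$h1)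
    have h2' : T *ᵥ ⇑(b j) = _ • ⇑(b j) := congr(⇑$h2)
    have hA2 : A = (1/2 : ℂ) • (S - Complex.I • T) := by
      rw [hS, hT, smul_smul, Complex.I_mul_I]
      module
    refine ⟨(1/2 : ℂ) * ((hint.subordinateOrthonormalBasisIndex hn j horth').1.2 -
      Complex.I * (hint.subordinateOrthonormalBasisIndex hn j horth').1.1), ?_⟩
    rw [hA2, smul_mulVec, sub_mulVec, smul_mulVec, h1', h2', smul_smul, ← sub_smul, smul_smul]
  choose d hd using hb
  let U : unitary (Matrix (Fin m) (Fin m) ℂ) :=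
    ⟨(EuclideanSpace.basisFun (Fin m) ℂ).toBasis.toMatrix b.toBasis,
      (EuclideanSpace.basisFun (Fin m) ℂ).toMatrix_orthonormalBasis_mem_unitary b⟩
  refine ⟨U, d, ?_⟩
  have hU : ∀ i j, (U : Matrix (Fin m) (Fin m) ℂ) i j = b j i := fun _ _ => rfl
  have : A * U = (U : Matrix (Fin m) (Fin m) ℂ) * diagonal d := by
    ext i j
    rw [mul_diagonal]
    have := congrFun (hd j) i
    simp only [Pi.smul_apply, smul_eq_mul] at this
    rw [hU, mul_comm, ← this]
    rfl
  have hUU : (U : Matrix (Fin m) (Fin m) ℂ) * star (U : Matrix (Fin m) (Fin m) ℂ) = 1 :=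
    Unitary.coe_mul_star_self U
  rw [← this, mul_assoc, hUU, mul_one]

theorem frob_sq {m n : ℕ} (X : Matrix (Fin m) (Fin n) ℂ) :
    (Matrix.trace (Xᴴ * X)).re = ∑ j, ∑ i, ‖X i j‖ ^ 2 := by
  simp only [Matrix.trace, Matrix.diag, Matrix.mul_apply, conjTranspose_apply, Complex.re_sum]
  refine Finset.sum_congr rfl fun j _ => Finset.sum_congr rfl fun i _ => ?_
  rw [← Complex.normSq_eq_norm_sq, Complex.normSq_apply]
  simp

theorem frob_unitary {m n : ℕ} (X : Matrix (Fin m) (Fin n) ℂ)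
    (U : unitary (Matrix (Fin m) (Fin m) ℂ)) (V : unitary (Matrix (Fin n) (Fin n) ℂ)) :
    frobNormC (star (U : Matrix (Fin m) (Fin m) ℂ) * X * (V : Matrix (Fin n) (Fin n) ℂ))
      = frobNormC X := by
  unfold frobNormC
  have hU : (U : Matrix (Fin m) (Fin m) ℂ) * (U : Matrix (Fin m) (Fin m) ℂ)ᴴ = 1 :=
    Unitary.coe_mul_star_self U
  have hV : (V : Matrix (Fin n) (Fin n) ℂ) * (V : Matrix (Fin n) (Fin n) ℂ)ᴴ = 1 :=
    Unitary.coe_mul_star_self V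
  congr 2
  rw [star_eq_conjTranspose, ← Matrix.mul_assoc, trace_mul_comm]
  simp only [conjTranspose_mul, conjTranspose_conjTranspose]
  simp only [← Matrix.mul_assoc]
  rw [hV, Matrix.one_mul]
  rw [Matrix.mul_assoc Xᴴ, hU, Matrix.mul_one]

/-- Sylvester-equation bound (Bhatia VII.2.8): if `A`, `B` are normal with spectra at
distance at least `δ > 0` and `AX − XB = Y`, then `‖X‖_F ≤ ‖Y‖_F/δ`. -/
theorem sylvester_bound (m n : ℕ)
    (A : Matrix (Fin m) (Fin m) ℂ) (B : Matrix (Fin n) (Fin n) ℂ)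
    (hA : IsStarNormal A) (hB : IsStarNormal B)
    (δ : ℝ) (hδ : 0 < δ)
    (hdist : ∀ l ∈ spectrum ℂ A, ∀ μ ∈ spectrum ℂ B, δ ≤ ‖l - μ‖)
    (X Y : Matrix (Fin m) (Fin n) ℂ)
    (hXY : A * X - X * B = Y) :
    frobNormC X ≤ frobNormC Y / δ := by
  obtain ⟨U, a, hUA⟩ := normal_diag A hA
  obtain ⟨V, b, hVB⟩ := normal_diag B hB
  have ha : spectrum ℂ A = Set.range a := by
    rw [hUA, Unitary.spectrum_star_right_conjugate, spectrum_diagonal]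
  have hb : spectrum ℂ B = Set.range b := by
    rw [hVB, Unitary.spectrum_star_right_conjugate, spectrum_diagonal]
  have hd : ∀ i j, δ ≤ ‖a i - b j‖ := fun i j =>
    hdist _ (ha ▸ Set.mem_range_self i) _ (hb ▸ Set.mem_range_self j)
  have hU : star (U : Matrix (Fin m) (Fin m) ℂ) * (U : Matrix (Fin m) (Fin m) ℂ) = 1 :=
    Unitary.coe_star_mul_self U
  have hV : star (V : Matrix (Fin n) (Fin n) ℂ) * (V : Matrix (Fin n) (Fin n) ℂ) = 1 :=
    Unitary.coe_star_mul_self V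
  rw [← frob_unitary X U V, ← frob_unitary Y U V]
  set X' := star (U : Matrix (Fin m) (Fin m) ℂ) * X * (V : Matrix (Fin n) (Fin n) ℂ) with hX'
  have hY' : star (U : Matrix (Fin m) (Fin m) ℂ) * Y * (V : Matrix (Fin n) (Fin n) ℂ)
      = diagonal a * X' - X' * diagonal b := by
    rw [← hXY, hUA, hVB, hX', Matrix.mul_sub, Matrix.sub_mul]
    simp only [← Matrix.mul_assoc]
    rw [hU, Matrix.one_mul, Matrix.mul_assoc _ (star (V : Matrix (Fin n) (Fin n) ℂ)), hV,
      Matrix.mul_one]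
  rw [hY', le_div_iff₀ hδ]
  unfold frobNormC
  rw [frob_sq, frob_sq]
  refine Real.le_sqrt_of_sq_le ?_
  rw [mul_pow, Real.sq_sqrt (by positivity), Finset.sum_mul]
  refine Finset.sum_le_sum fun j _ => ?_
  rw [Finset.sum_mul]
  refine Finset.sum_le_sum fun i _ => ?_
  rw [Matrix.sub_apply, diagonal_mul, mul_diagonal, mul_comm (X' i j), ← sub_mul, norm_mul,
    mul_pow, mul_comm]
  have := hd i j
  gcongr
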